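/- Let R₁ ↦ R₂ be an elementary move of rectangular diagrams of links associated with the rectangle [θ₁;θ₂]×[φ₁;φ₂]. Then the symmetric difference R̂₁ △ R̂₂ of the associated links in S³ is a union of two disjoint open arcs α ⊂ R̂₁ and β ⊂ R̂₂ whose closure is the simple closed curve {θ₁,θ₂}*{φ₁,φ₂}, and there exists an embedded 2-disc d contained in the join [θ₁;θ₂]*[φ₁;φ₂] ⊂ S³ such that d ∩ (R̂₁ ∪ R̂₂) = ∂d = the closure of α ∪ β. -/

import Mathlib

open scoped Real

noncomputable section

namespace RectDiag

instance : DecidableEq Real.Angle := Classical.decEq _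

/-- The torus `T² = S¹ × S¹` with angular coordinates `(θ, φ)`. -/
abbrev Torus := Real.Angle × Real.Angle

/-- The length of the arc running from `x` to `y` in the positive direction. -/
def arcLen (x y : Real.Angle) : ℝ :=
  if (y - x).toReal < 0 then (y - x).toReal + 2 * Real.pi else (y - x).toReal

/-- The closed arc `[x;y]` running from `x` to `y` in the positive direction. -/
def Arc (x y : Real.Angle) : Set Real.Angle :=
  {z | ∃ t : ℝ, 0 ≤ t ∧ t ≤ arcLen x y ∧ z = x + (t : Real.Angle)}

/-- The open arc `(x;y)`, the interior of `[x;y]`. -/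
def ArcInt (x y : Real.Angle) : Set Real.Angle :=
  {z | ∃ t : ℝ, 0 < t ∧ t < arcLen x y ∧ z = x + (t : Real.Angle)}

/-- Every meridian `{θ}×S¹` contains no or exactly two points of `V`, of opposite signs. -/
def MeridianOK (V : Finset Torus) (sgn : Torus → Bool) : Prop :=
  ∀ θ : Real.Angle, (∀ v ∈ V, v.1 ≠ θ) ∨
    ∃ u w, u ∈ V ∧ w ∈ V ∧ u ≠ w ∧ u.1 = θ ∧ w.1 = θ ∧ sgn u ≠ sgn w ∧
      ∀ x ∈ V, x.1 = θ → x = u ∨ x = w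

/-- Every longitude `S¹×{φ}` contains no or exactly two points of `V`, of opposite signs. -/
def LongitudeOK (V : Finset Torus) (sgn : Torus → Bool) : Prop :=
  ∀ φ : Real.Angle, (∀ v ∈ V, v.2 ≠ φ) ∨
    ∃ u w, u ∈ V ∧ w ∈ V ∧ u ≠ w ∧ u.2 = φ ∧ w.2 = φ ∧ sgn u ≠ sgn w ∧
      ∀ x ∈ V, x.2 = φ → x = u ∨ x = w

/-- `V` with sign assignment `sgn` satisfies the conditions of a rectangular diagram. -/
def IsDiagSet (V : Finset Torus) (sgn : Torus → Bool) : Prop :=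
  MeridianOK V sgn ∧ LongitudeOK V sgn

/-- `S` is a connected component of `V`: a minimal nonempty subset of `V` that is itself a
rectangular diagram of a link (with the inherited signs). -/
def IsComponent (V : Finset Torus) (sgn : Torus → Bool) (S : Finset Torus) : Prop :=
  S ⊆ V ∧ S.Nonempty ∧ IsDiagSet S sgn ∧
    ∀ S' ⊆ S, S'.Nonempty → IsDiagSet S' sgn → S' = S

/-- An oriented rectangular diagram of a link with numbered connected components:
a finite subset of the torus with a sign assignment satisfying the meridian/longitude
conditions, together with a numbering of the vertices which is constant exactly on
connected components. -/
structure RectDiagram where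
  verts : Finset Torus
  sgn : Torus → Bool
  comp : Torus → ℕ
  diag : IsDiagSet verts sgn
  comp_eq_iff : ∀ u ∈ verts, ∀ v ∈ verts,
    (comp u = comp v ↔ ∃ S, IsComponent verts sgn S ∧ u ∈ S ∧ v ∈ S)

/-- `{u,v}` is a (vertical or horizontal) edge of the diagram `R`. -/
def IsEdge (R : RectDiagram) (u v : Torus) : Prop :=
  u ∈ R.verts ∧ v ∈ R.verts ∧ u ≠ v ∧ (u.1 = v.1 ∨ u.2 = v.2)

/-- The four corner points `{θ₁,θ₂}×{φ₁,φ₂}`. -/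
def corners (t1 t2 p1 p2 : Real.Angle) : Finset Torus :=
  {(t1, p1), (t1, p2), (t2, p1), (t2, p2)}

/-- The rectangle `[θ₁;θ₂]×[φ₁;φ₂] ⊆ T²`. -/
def RectSet (t1 t2 p1 p2 : Real.Angle) : Set Torus :=
  {p | p.1 ∈ Arc t1 t2 ∧ p.2 ∈ Arc p1 p2}

/-- `R₁ ↦ R₂` is an elementary move associated with the rectangle `[θ₁;θ₂]×[φ₁;φ₂]`. -/
def IsElemMoveWith (R₁ R₂ : RectDiagram) (t1 t2 p1 p2 : Real.Angle) : Prop :=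
  t1 ≠ t2 ∧ p1 ≠ p2 ∧
  symmDiff R₁.verts R₂.verts = corners t1 t2 p1 p2 ∧
  (∃ u v : Torus, u ∈ symmDiff R₁.verts R₂.verts ∧ v ∈ symmDiff R₁.verts R₂.verts ∧
      (IsEdge R₁ u v ∨ IsEdge R₂ u v)) ∧
  ¬ R₁.verts ⊆ R₂.verts ∧ ¬ R₂.verts ⊆ R₁.verts ∧
  RectSet t1 t2 p1 p2 ∩ (↑R₁.verts ∪ ↑R₂.verts) = ↑(corners t1 t2 p1 p2) ∧
  ∀ v ∈ R₁.verts ∩ R₂.verts, R₁.sgn v = R₂.sgn v ∧ R₁.comp v = R₂.comp v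

/-- `R₁ ↦ R₂` is an elementary move. -/
def IsElemMove (R₁ R₂ : RectDiagram) : Prop :=
  ∃ t1 t2 p1 p2 : Real.Angle, IsElemMoveWith R₁ R₂ t1 t2 p1 p2

/-- An exchange move. -/
def IsExchange (R₁ R₂ : RectDiagram) : Prop :=
  IsElemMove R₁ R₂ ∧ R₂.verts.card = R₁.verts.card

/-- A stabilization. -/
def IsStab (R₁ R₂ : RectDiagram) : Prop :=
  IsElemMove R₁ R₂ ∧ R₂.verts.card = R₁.verts.card + 2

/-- A destabilization. -/
def IsDestab (R₁ R₂ : RectDiagram) : Prop :=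
  IsElemMove R₁ R₂ ∧ R₁.verts.card = R₂.verts.card + 2

/-- A stabilization associated with a given rectangle. -/
def IsStabWith (R₁ R₂ : RectDiagram) (t1 t2 p1 p2 : Real.Angle) : Prop :=
  IsElemMoveWith R₁ R₂ t1 t2 p1 p2 ∧ R₂.verts.card = R₁.verts.card + 2

/-- The type I corner condition: `R₁ ∩ V ⊆ {(θ₁,φ₁),(θ₂,φ₂)}`. -/
def TypeICornerCond (R₁ : RectDiagram) (t1 t2 p1 p2 : Real.Angle) : Prop :=
  ∀ v ∈ R₁.verts, v ∈ corners t1 t2 p1 p2 → v = (t1, p1) ∨ v = (t2, p2)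

/-- The type II corner condition: `R₁ ∩ V ⊆ {(θ₁,φ₂),(θ₂,φ₁)}`. -/
def TypeIICornerCond (R₁ : RectDiagram) (t1 t2 p1 p2 : Real.Angle) : Prop :=
  ∀ v ∈ R₁.verts, v ∈ corners t1 t2 p1 p2 → v = (t1, p2) ∨ v = (t2, p1)

/-- `R₁ ↦ R₂` is a type I stabilization. -/
def IsTypeIStab (R₁ R₂ : RectDiagram) : Prop :=
  ∃ t1 t2 p1 p2, IsStabWith R₁ R₂ t1 t2 p1 p2 ∧ TypeICornerCond R₁ t1 t2 p1 p2

/-- `R₁ ↦ R₂` is a type II stabilization. -/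
def IsTypeIIStab (R₁ R₂ : RectDiagram) : Prop :=
  ∃ t1 t2 p1 p2, IsStabWith R₁ R₂ t1 t2 p1 p2 ∧ TypeIICornerCond R₁ t1 t2 p1 p2

/-- `R₁ ↦ R₂` is a type I destabilization. -/
def IsTypeIDestab (R₁ R₂ : RectDiagram) : Prop := IsTypeIStab R₂ R₁

/-- `R₁ ↦ R₂` is a type II destabilization. -/
def IsTypeIIDestab (R₁ R₂ : RectDiagram) : Prop := IsTypeIIStab R₂ R₁

/-- The four oriented types `→I`, `←I`, `→II`, `←II` of (de)stabilizations. -/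
inductive OType
  | posI
  | negI
  | posII
  | negII
deriving DecidableEq

/-- Whether an oriented type is of (unoriented) type I. -/
def OType.isI : OType → Bool
  | .posI => true
  | .negI => true
  | _ => false

/-- `R₁ ↦ R₂` is a stabilization of the given oriented type. -/
def IsStabOfOType (R₁ R₂ : RectDiagram) (t : OType) : Prop :=
  ∃ t1 t2 p1 p2, IsStabWith R₁ R₂ t1 t2 p1 p2 ∧
    ∃ p0, (p0 = p1 ∨ p0 = p2) ∧ (t1, p0) ∈ R₂.verts ∧ (t2, p0) ∈ R₂.verts ∧
      (match t with
        | .posI => TypeICornerCond R₁ t1 t2 p1 p2 ∧ R₂.sgn (t2, p0) = true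
        | .negI => TypeICornerCond R₁ t1 t2 p1 p2 ∧ R₂.sgn (t2, p0) = false
        | .posII => TypeIICornerCond R₁ t1 t2 p1 p2 ∧ R₂.sgn (t2, p0) = true
        | .negII => TypeIICornerCond R₁ t1 t2 p1 p2 ∧ R₂.sgn (t2, p0) = false)

/-- `R₁ ↦ R₂` is a destabilization of the given oriented type. -/
def IsDestabOfOType (R₁ R₂ : RectDiagram) (t : OType) : Prop := IsStabOfOType R₂ R₁ t

/-- The move `R₁ ↦ R₂` is performed on (modifies) the connected component number `i`. -/
def ModifiesComp (R₁ R₂ : RectDiagram) (i : ℕ) : Prop :=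
  ∃ v ∈ R₁.verts, v ∉ R₂.verts ∧ R₁.comp v = i

/-- The kind of an elementary move: an exchange, a stabilization of oriented type `t`
on the component number `i`, or a destabilization of oriented type `t` on the component
number `i`. -/
inductive MoveKind
  | exchange
  | stab (t : OType) (i : ℕ)
  | destab (t : OType) (i : ℕ)
deriving DecidableEq

/-- The pair `(R₁, R₂)` is an elementary move realizing the given kind. -/
def KindOk (R₁ R₂ : RectDiagram) : MoveKind → Prop
  | .exchange => IsExchange R₁ R₂
  | .stab t i => IsStabOfOType R₁ R₂ t ∧ ModifiesComp R₁ R₂ i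
  | .destab t i => IsDestabOfOType R₁ R₂ t ∧ ModifiesComp R₁ R₂ i

/-- `LChain R s R'` : `s` is a chain of elementary moves from `R` to `R'`, each move
labeled by its kind. -/
def LChain : RectDiagram → List (MoveKind × RectDiagram) → RectDiagram → Prop
  | R, [], R' => R = R'
  | R, (k, S) :: rest, R' => KindOk R S k ∧ LChain S rest R'

/-- `e^{ia} ∈ ℂ` for an angle `a`. -/
def expA (a : Real.Angle) : ℂ := Complex.exp (a.toReal * Complex.I)

/-- The point of `S³ ⊂ ℂ²` with join coordinates `(θ, φ, τ)`:
`(cos(πτ/2)·e^{iφ}, sin(πτ/2)·e^{iθ})`. -/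
def sphPt (t p : Real.Angle) (s : ℝ) : ℂ × ℂ :=
  ((Real.cos (Real.pi * s / 2) : ℂ) * expA p, (Real.sin (Real.pi * s / 2) : ℂ) * expA t)

/-- The arc `v̂ ⊂ S³` associated with a point `v` of the torus. -/
def vertArc (v : Torus) : Set (ℂ × ℂ) :=
  {q | ∃ s : ℝ, 0 ≤ s ∧ s ≤ 1 ∧ q = sphPt v.1 v.2 s}

/-- The link `R̂ ⊂ S³` associated with a rectangular diagram `R`. -/
def hatLink (R : RectDiagram) : Set (ℂ × ℂ) := ⋃ v ∈ R.verts, vertArc v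

/-- The join `I * J ⊂ S³` of two subsets of the circle. -/
def joinSet (I J : Set Real.Angle) : Set (ℂ × ℂ) :=
  {q | ∃ t ∈ I, ∃ p ∈ J, ∃ s : ℝ, 0 ≤ s ∧ s ≤ 1 ∧ q = sphPt t p s}

/-- A subset of `ℂ²` is an open arc if it is homeomorphic to an open interval. -/
def IsOpenArc (A : Set (ℂ × ℂ)) : Prop :=
  Nonempty (↥(Set.Ioo (0 : ℝ) 1) ≃ₜ ↥A)

/-- The closed unit disc in `ℂ`. -/
def unitDisc : Set ℂ := Metric.closedBall 0 1

open Topology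

theorem expA_coe (r : ℝ) : expA (r : Real.Angle) = Complex.exp (r * Complex.I) := by
  have h : ((Real.Angle.toCircle (r : Real.Angle) : Circle) : ℂ)
      = (Real.Angle.toCircle (((r : Real.Angle).toReal : ℝ) : Real.Angle) : Circle) := by
    rw [Real.Angle.coe_toReal]
  rw [Real.Angle.toCircle_coe, Real.Angle.toCircle_coe, Circle.coe_exp, Circle.coe_exp] at h
  exact h.symm

theorem expA_eq_toCircle (a : Real.Angle) : expA a = (AddCircle.homeomorphCircle' a : Circle) := by
  induction a using Real.Angle.induction_on with
  | _ r => rw [expA_coe]; exact (Circle.coe_exp r).symm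

theorem continuous_expA : Continuous expA := by
  have : expA = fun a => ((AddCircle.homeomorphCircle' a : Circle) : ℂ) :=
    funext expA_eq_toCircle
  rw [this]
  exact continuous_subtype_val.comp AddCircle.homeomorphCircle'.continuous

theorem expA_injective : Function.Injective expA := by
  intro a b h
  rw [expA_eq_toCircle, expA_eq_toCircle] at h
  exact AddCircle.homeomorphCircle'.injective (Circle.coe_injective h)

@[simp] theorem norm_expA (a : Real.Angle) : ‖expA a‖ = 1 := by
  rw [expA_eq_toCircle]; exact Circle.norm_coe _

theorem half_pi_mul_mem {s : ℝ} (h0 : 0 ≤ s) (h1 : s ≤ 1) :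
    0 ≤ π * s / 2 ∧ π * s / 2 ≤ π / 2 := by
  have := Real.pi_pos
  constructor
  · positivity
  · nlinarith

theorem sphPt_zero (t t' p : Real.Angle) : sphPt t p 0 = sphPt t' p 0 := by simp [sphPt]

theorem sphPt_one (t p p' : Real.Angle) : sphPt t p 1 = sphPt t p' 1 := by simp [sphPt]

theorem sphPt_inj {t t' p p' : Real.Angle} {s s' : ℝ} (h0 : 0 ≤ s) (h1 : s ≤ 1)
    (h0' : 0 ≤ s') (h1' : s' ≤ 1) (h : sphPt t p s = sphPt t' p' s') :
    s = s' ∧ (s ≠ 0 → t = t') ∧ (s ≠ 1 → p = p') := by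
  obtain ⟨a0, a1⟩ := half_pi_mul_mem h0 h1
  obtain ⟨b0, b1⟩ := half_pi_mul_mem h0' h1'
  have hpi := Real.pi_pos
  simp only [sphPt, Prod.mk.injEq] at h
  obtain ⟨hc, hs⟩ := h
  have hss : s = s' := by
    have hn := congrArg norm hc
    simp only [norm_mul, norm_expA, mul_one, Complex.norm_real, Real.norm_eq_abs] at hn
    rw [abs_of_nonneg (Real.cos_nonneg_of_neg_pi_div_two_le_of_le (by linarith) a1),
      abs_of_nonneg (Real.cos_nonneg_of_neg_pi_div_two_le_of_le (by linarith) b1)] at hn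
    have := Real.injOn_cos ⟨a0, by linarith⟩ ⟨b0, by linarith⟩ hn
    have h2 : π * s = π * s' := by linarith
    exact mul_left_cancel₀ hpi.ne' h2
  subst hss
  refine ⟨rfl, fun hs0 => ?_, fun hs1 => ?_⟩
  · have hpos : 0 < s := lt_of_le_of_ne h0 (Ne.symm hs0)
    have hne : Real.sin (π * s / 2) ≠ 0 :=
      (Real.sin_pos_of_pos_of_lt_pi (by positivity) (by linarith)).ne'
    exact expA_injective (mul_left_cancel₀ (Complex.ofReal_ne_zero.mpr hne) hs)
  · have hlt : s < 1 := lt_of_le_of_ne h1 hs1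
    have hne : Real.cos (π * s / 2) ≠ 0 :=
      (Real.cos_pos_of_mem_Ioo ⟨by linarith, by nlinarith⟩).ne'
    exact expA_injective (mul_left_cancel₀ (Complex.ofReal_ne_zero.mpr hne) hc)

theorem arcLen_pos {x y : Real.Angle} (h : x ≠ y) : 0 < arcLen x y := by
  have h0 : (y - x).toReal ≠ 0 := by
    rw [Ne, Real.Angle.toReal_eq_zero_iff, sub_eq_zero]; exact fun e => h e.symm
  have := Real.Angle.neg_pi_lt_toReal (y - x)
  unfold arcLen
  split_ifs with hlt
  · linarith [Real.pi_pos]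
  · exact lt_of_le_of_ne (not_lt.mp hlt) h0.symm

theorem arcLen_lt (x y : Real.Angle) : arcLen x y < 2 * π := by
  have := Real.Angle.toReal_le_pi (y - x)
  unfold arcLen
  split_ifs with hlt <;> linarith [Real.pi_pos]

theorem add_arcLen (x y : Real.Angle) : x + (arcLen x y : Real.Angle) = y := by
  unfold arcLen
  split_ifs <;> simp

theorem coe_angle_inj {a b : ℝ} (hab : |a - b| < 2 * π) (h : (a : Real.Angle) = b) : a = b := by
  rw [Real.Angle.angle_eq_iff_two_pi_dvd_sub] at h
  obtain ⟨k, hk⟩ := h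
  rw [hk, abs_mul, abs_of_pos Real.two_pi_pos] at hab
  have hk1 : |(k : ℝ)| < 1 := by nlinarith [Real.two_pi_pos]
  have hk0 : k = 0 := Int.abs_lt_one_iff.mp (by exact_mod_cast hk1)
  rw [hk0] at hk
  simp at hk
  linarith

theorem mul_abs_inj {x y : ℝ} (h : x * |x| = y * |y|) : x = y := by
  rcases le_total 0 x with hx | hx <;> rcases le_total 0 y with hy | hy <;>
    simp only [abs_of_nonneg, abs_of_nonpos, hx, hy] at h
  · nlinarith
  · have := mul_self_nonneg x
    have := mul_self_nonneg y
    rw [mul_self_eq_zero.mp (by linarith : x * x = 0), mul_self_eq_zero.mp (by linarith : y * y = 0)]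
  · have := mul_self_nonneg x
    have := mul_self_nonneg y
    rw [mul_self_eq_zero.mp (by linarith : x * x = 0), mul_self_eq_zero.mp (by linarith : y * y = 0)]
  · nlinarith

/-- A product with one factor continuous and the other bounded is continuous as soon as the
bounded factor is continuous off the zeros of the first. -/
theorem continuous_mul_of_bounded {X : Type*} [TopologicalSpace X] {c g : X → ℂ}
    (hc : Continuous c) (hg : ∀ x, ‖g x‖ ≤ 1) (hgc : ∀ x, c x ≠ 0 → ContinuousAt g x) :
    Continuous fun x => c x * g x := by
  rw [continuous_iff_continuousAt]
  intro x
  by_cases hx : c x = 0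
  · have h1 : Filter.Tendsto (fun y => ‖c y‖) (𝓝 x) (𝓝 0) := by
      have := (hc.norm).tendsto x
      simpa [hx] using this
    have h2 : Filter.Tendsto (fun y => c y * g y) (𝓝 x) (𝓝 0) := by
      refine squeeze_zero_norm (fun y => ?_) h1
      rw [norm_mul]
      exact mul_le_of_le_one_right (norm_nonneg _) (hg y)
    simpa [ContinuousAt, hx] using h2
  · exact hc.continuousAt.mul (hgc x hx)

/-- The `τ`-coordinate of the saddle disc. -/
def saddleHt (z : ℂ) : ℝ := (1 + z.re ^ 2 - z.im ^ 2) / 2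

/-- The position along the first arc of a point of the saddle disc, as a fraction of the length. -/
def saddleU (z : ℂ) : ℝ := (1 + z.re * |z.re| / saddleHt z) / 2

/-- The position along the second arc of a point of the saddle disc, as a fraction of the
length. -/
def saddleV (z : ℂ) : ℝ := (1 + z.im * |z.im| / (1 - saddleHt z)) / 2

/-- The saddle-shaped disc in the join `[t1;t2] * [p1;p2]` spanned by `{t1,t2} * {p1,p2}`. -/
def saddle (t1 t2 p1 p2 : Real.Angle) (z : ℂ) : ℂ × ℂ :=
  sphPt (t1 + ((arcLen t1 t2 * saddleU z : ℝ) : Real.Angle))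
    (p1 + ((arcLen p1 p2 * saddleV z : ℝ) : Real.Angle)) (saddleHt z)

theorem norm_sq_eq (z : ℂ) : ‖z‖ ^ 2 = z.re ^ 2 + z.im ^ 2 := by
  rw [← Complex.normSq_eq_norm_sq, Complex.normSq_apply]; ring

theorem continuous_saddleHt : Continuous saddleHt := by unfold saddleHt; fun_prop

theorem continuous_saddle (t1 t2 p1 p2 : Real.Angle) : Continuous (saddle t1 t2 p1 p2) := by
  have hw := continuous_saddleHt
  unfold saddle sphPt
  refine Continuous.prodMk ?_ ?_
  · refine continuous_mul_of_bounded (by fun_prop) (fun z => (norm_expA _).le) fun z hz => ?_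
    have h1 : 1 - saddleHt z ≠ 0 := by
      intro h
      apply hz
      rw [show saddleHt z = 1 by linarith]
      simp
    refine continuous_expA.continuousAt.comp (ContinuousAt.add continuousAt_const ?_)
    refine Real.Angle.continuous_coe.continuousAt.comp ?_
    unfold saddleV
    have : ContinuousAt (fun z : ℂ => z.im * |z.im| / (1 - saddleHt z)) z :=
      ContinuousAt.div (by fun_prop) (by fun_prop) h1
    fun_prop
  · refine continuous_mul_of_bounded (by fun_prop) (fun z => (norm_expA _).le) fun z hz => ?_
    have h1 : saddleHt z ≠ 0 := by
      intro h
      apply hz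
      rw [h]
      simp
    refine continuous_expA.continuousAt.comp (ContinuousAt.add continuousAt_const ?_)
    refine Real.Angle.continuous_coe.continuousAt.comp ?_
    unfold saddleU
    have : ContinuousAt (fun z : ℂ => z.re * |z.re| / saddleHt z) z :=
      ContinuousAt.div (by fun_prop) (by fun_prop) h1
    fun_prop

theorem abs_re_le_saddleHt {z : ℂ} (hz : ‖z‖ ≤ 1) : abs (z.re * |z.re|) ≤ saddleHt z := by
  have := norm_sq_eq z
  have h1 : ‖z‖ ^ 2 ≤ 1 := pow_le_one₀ (norm_nonneg _) hz
  rw [abs_mul, abs_abs, abs_mul_abs_self, saddleHt]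
  linarith

theorem abs_im_le_saddleHt {z : ℂ} (hz : ‖z‖ ≤ 1) : abs (z.im * |z.im|) ≤ 1 - saddleHt z := by
  have := norm_sq_eq z
  have h1 : ‖z‖ ^ 2 ≤ 1 := pow_le_one₀ (norm_nonneg _) hz
  rw [abs_mul, abs_abs, abs_mul_abs_self, saddleHt]
  linarith

theorem abs_re_lt_saddleHt {z : ℂ} (hz : ‖z‖ < 1) : abs (z.re * |z.re|) < saddleHt z := by
  have := norm_sq_eq z
  have h1 : ‖z‖ ^ 2 < 1 := pow_lt_one₀ (norm_nonneg _) hz two_ne_zero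
  rw [abs_mul, abs_abs, abs_mul_abs_self, saddleHt]
  linarith

theorem abs_im_lt_saddleHt {z : ℂ} (hz : ‖z‖ < 1) : abs (z.im * |z.im|) < 1 - saddleHt z := by
  have := norm_sq_eq z
  have h1 : ‖z‖ ^ 2 < 1 := pow_lt_one₀ (norm_nonneg _) hz two_ne_zero
  rw [abs_mul, abs_abs, abs_mul_abs_self, saddleHt]
  linarith

theorem saddleHt_mem {z : ℂ} (hz : ‖z‖ ≤ 1) : 0 ≤ saddleHt z ∧ saddleHt z ≤ 1 :=
  ⟨(abs_nonneg _).trans (abs_re_le_saddleHt hz),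
    by linarith [(abs_nonneg _).trans (abs_im_le_saddleHt hz)]⟩

theorem half_one_add_div_mem {a w : ℝ} (h : |a| ≤ w) :
    0 ≤ (1 + a / w) / 2 ∧ (1 + a / w) / 2 ≤ 1 := by
  have : |a / w| ≤ 1 := by
    rw [abs_div, abs_of_nonneg ((abs_nonneg a).trans h)]
    exact div_le_one_of_le₀ h ((abs_nonneg a).trans h)
  obtain ⟨h1, h2⟩ := abs_le.mp this
  constructor <;> linarith

theorem half_one_add_div_mem_of_lt {a w : ℝ} (h : |a| < w) :
    0 < (1 + a / w) / 2 ∧ (1 + a / w) / 2 < 1 := by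
  have hw : 0 < w := (abs_nonneg a).trans_lt h
  have : |a / w| < 1 := by
    rw [abs_div, abs_of_pos hw, div_lt_one hw]
    exact h
  obtain ⟨h1, h2⟩ := abs_lt.mp this
  constructor <;> linarith

theorem saddleU_mem {z : ℂ} (hz : ‖z‖ ≤ 1) : 0 ≤ saddleU z ∧ saddleU z ≤ 1 :=
  half_one_add_div_mem (abs_re_le_saddleHt hz)

theorem saddleV_mem {z : ℂ} (hz : ‖z‖ ≤ 1) : 0 ≤ saddleV z ∧ saddleV z ≤ 1 :=
  half_one_add_div_mem (abs_im_le_saddleHt hz)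

theorem add_arc_inj {t1 t2 : Real.Angle} (ht : t1 ≠ t2) {a b : ℝ} (ha : 0 ≤ a ∧ a ≤ 1)
    (hb : 0 ≤ b ∧ b ≤ 1)
    (h : t1 + ((arcLen t1 t2 * a : ℝ) : Real.Angle) = t1 + ((arcLen t1 t2 * b : ℝ) : Real.Angle)) :
    a = b := by
  have hL := arcLen_pos ht
  have hL2 := arcLen_lt t1 t2
  refine mul_left_cancel₀ hL.ne' (coe_angle_inj ?_ (add_left_cancel h))
  rw [← mul_sub, abs_mul, abs_of_pos hL]
  have : |a - b| ≤ 1 := abs_le.mpr ⟨by linarith [ha.1, hb.2], by linarith [ha.2, hb.1]⟩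
  nlinarith

theorem saddle_injOn {t1 t2 p1 p2 : Real.Angle} (ht : t1 ≠ t2) (hp : p1 ≠ p2) {z z' : ℂ}
    (hz : ‖z‖ ≤ 1) (hz' : ‖z'‖ ≤ 1) (h : saddle t1 t2 p1 p2 z = saddle t1 t2 p1 p2 z') :
    z = z' := by
  obtain ⟨h0, h1⟩ := saddleHt_mem hz
  obtain ⟨h0', h1'⟩ := saddleHt_mem hz'
  obtain ⟨hs, hu, hv⟩ := sphPt_inj h0 h1 h0' h1' h
  have ha := abs_re_le_saddleHt hz
  have hb := abs_im_le_saddleHt hz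
  have ha' := abs_re_le_saddleHt hz'
  have hb' := abs_im_le_saddleHt hz'
  apply Complex.ext
  · apply mul_abs_inj
    by_cases hw : saddleHt z = 0
    · rw [← hs, hw] at ha'
      rw [hw] at ha
      rw [abs_nonpos_iff.mp ha, abs_nonpos_iff.mp ha']
    · have := add_arc_inj ht (saddleU_mem hz) (saddleU_mem hz') (hu hw)
      unfold saddleU at this
      rw [← hs] at this
      exact (div_left_inj' hw).mp (by linarith)
  · apply mul_abs_inj
    by_cases hw : saddleHt z = 1
    · rw [← hs, hw, sub_self] at hb'
      rw [hw, sub_self] at hb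
      rw [abs_nonpos_iff.mp hb, abs_nonpos_iff.mp hb']
    · have := add_arc_inj hp (saddleV_mem hz) (saddleV_mem hz') (hv hw)
      unfold saddleV at this
      rw [← hs] at this
      have hw' : 1 - saddleHt z ≠ 0 := fun h => hw (by linarith)
      exact (div_left_inj' hw').mp (by linarith)

/-- `T` is an endpoint of the arc `[a;b]` lying on the side given by the sign of `x`. -/
def OnSide (a b : Real.Angle) (x : ℝ) (T : Real.Angle) : Prop :=
  (T = a ∧ x ≤ 0) ∨ (T = b ∧ 0 ≤ x)

theorem exists_onSide (a b : Real.Angle) (x : ℝ) : ∃ T, OnSide a b x T :=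
  (le_total x 0).elim (fun h => ⟨a, .inl ⟨rfl, h⟩⟩) fun h => ⟨b, .inr ⟨rfl, h⟩⟩

theorem onSide_endpoint {a b T : Real.Angle} {x w : ℝ} (hT : OnSide a b x T) (hx : x ≠ 0)
    (hw : w = x ^ 2) :
    a + ((arcLen a b * ((1 + x * |x| / w) / 2) : ℝ) : Real.Angle) = T := by
  rcases hT with ⟨rfl, h⟩ | ⟨rfl, h⟩
  · rw [abs_of_nonpos h, hw, show x * -x / x ^ 2 = -1 by field_simp]; simp
  · rw [abs_of_nonneg h, hw, show x * x / x ^ 2 = 1 by field_simp]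
    simpa using add_arcLen a T

theorem saddle_of_norm_eq_one {t1 t2 p1 p2 T P : Real.Angle} {z : ℂ} (hz : ‖z‖ = 1)
    (hT : OnSide t1 t2 z.re T) (hP : OnSide p1 p2 z.im P) :
    saddle t1 t2 p1 p2 z = sphPt T P (z.re ^ 2) := by
  have hn := norm_sq_eq z
  rw [hz] at hn
  have hw : saddleHt z = z.re ^ 2 := by unfold saddleHt; linarith
  have hw' : 1 - saddleHt z = z.im ^ 2 := by unfold saddleHt; linarith
  have hU : z.re ≠ 0 → t1 + ((arcLen t1 t2 * saddleU z : ℝ) : Real.Angle) = T :=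
    fun h => onSide_endpoint hT h hw
  have hV : z.im ≠ 0 → p1 + ((arcLen p1 p2 * saddleV z : ℝ) : Real.Angle) = P :=
    fun h => onSide_endpoint hP h hw'
  unfold saddle
  rw [hw]
  by_cases hx : z.re = 0
  · have hy : z.im ≠ 0 := by rintro h; rw [h, hx] at hn; norm_num at hn
    rw [hV hy, hx, zero_pow two_ne_zero]
    exact sphPt_zero _ _ _
  · rw [hU hx]
    by_cases hy : z.im = 0
    · have : z.re ^ 2 = 1 := by rw [hy] at hn; linarith
      rw [this]
      exact sphPt_one _ _ _
    · rw [hV hy]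

theorem saddle_image_sphere (t1 t2 p1 p2 : Real.Angle) :
    saddle t1 t2 p1 p2 '' {z | ‖z‖ = 1} = joinSet {t1, t2} {p1, p2} := by
  apply Set.Subset.antisymm
  · rintro _ ⟨z, hz, rfl⟩
    have hz : ‖z‖ = 1 := hz
    obtain ⟨T, hT⟩ := exists_onSide t1 t2 z.re
    obtain ⟨P, hP⟩ := exists_onSide p1 p2 z.im
    have hn := norm_sq_eq z
    rw [hz] at hn
    exact ⟨T, hT.imp And.left And.left, P, hP.imp And.left And.left, z.re ^ 2, sq_nonneg _,
      by nlinarith [sq_nonneg z.im], saddle_of_norm_eq_one hz hT hP⟩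
  · rintro _ ⟨T, hT, P, hP, s, h0, h1, rfl⟩
    have key : ∀ {a b c : Real.Angle} {r : ℝ}, c ∈ ({a, b} : Set Real.Angle) → 0 ≤ r →
        ∃ x : ℝ, x ^ 2 = r ∧ OnSide a b x c := by
      rintro a b c r (hc | hc) hr
      · exact ⟨-√r, by rw [neg_sq, Real.sq_sqrt hr], .inl ⟨hc, by simp⟩⟩
      · exact ⟨√r, Real.sq_sqrt hr, .inr ⟨hc, Real.sqrt_nonneg r⟩⟩
    obtain ⟨x, hx, hxT⟩ := key hT h0
    obtain ⟨y, hy, hyP⟩ := key hP (sub_nonneg.mpr h1)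
    have hz : ‖(⟨x, y⟩ : ℂ)‖ = 1 := by
      have := norm_sq_eq ⟨x, y⟩
      simp only [hx, hy, add_sub_cancel] at this
      exact (pow_eq_one_iff_of_nonneg (norm_nonneg _) two_ne_zero).mp this
    exact ⟨⟨x, y⟩, hz, by rw [saddle_of_norm_eq_one hz hxT hyP]; simp only [hx]⟩

theorem saddle_mem_join {t1 t2 p1 p2 : Real.Angle} (ht : t1 ≠ t2) (hp : p1 ≠ p2) {z : ℂ}
    (hz : ‖z‖ ≤ 1) : saddle t1 t2 p1 p2 z ∈ joinSet (Arc t1 t2) (Arc p1 p2) := by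
  have key : ∀ {a b : Real.Angle} {u : ℝ}, a ≠ b → 0 ≤ u ∧ u ≤ 1 →
      a + ((arcLen a b * u : ℝ) : Real.Angle) ∈ Arc a b := fun hab hu =>
    ⟨_, mul_nonneg (arcLen_pos hab).le hu.1,
      mul_le_of_le_one_right (arcLen_pos hab).le hu.2, rfl⟩
  obtain ⟨h0, h1⟩ := saddleHt_mem hz
  exact ⟨_, key ht (saddleU_mem hz), _, key hp (saddleV_mem hz), _, h0, h1, rfl⟩

/-- The interior of the saddle disc meets only arcs of vertices of the closed rectangle other
than its corners. -/
theorem saddle_interior_mem_vertArc {t1 t2 p1 p2 : Real.Angle} (ht : t1 ≠ t2) (hp : p1 ≠ p2)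
    {z : ℂ} (hz : ‖z‖ < 1) {v : Torus} (hv : saddle t1 t2 p1 p2 z ∈ vertArc v) :
    v ∈ RectSet t1 t2 p1 p2 ∧ v.1 ≠ t1 ∧ v.1 ≠ t2 := by
  obtain ⟨h0, h1⟩ := saddleHt_mem hz.le
  obtain ⟨s, s0, s1, hs⟩ := hv
  obtain ⟨-, hu, hv⟩ := sphPt_inj h0 h1 s0 s1 hs
  have hpos : 0 < saddleHt z := (abs_nonneg _).trans_lt (abs_re_lt_saddleHt hz)
  have hlt : 0 < 1 - saddleHt z := (abs_nonneg _).trans_lt (abs_im_lt_saddleHt hz)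
  have hu := hu hpos.ne'
  have hv := hv (by linarith)
  have hU : 0 < saddleU z ∧ saddleU z < 1 := half_one_add_div_mem_of_lt (abs_re_lt_saddleHt hz)
  have hV : 0 < saddleV z ∧ saddleV z < 1 := half_one_add_div_mem_of_lt (abs_im_lt_saddleHt hz)
  have hL := arcLen_pos ht
  have hM := arcLen_pos hp
  refine ⟨⟨⟨_, ?_, ?_, hu.symm⟩, ⟨_, ?_, ?_, hv.symm⟩⟩, fun h => ?_, fun h => ?_⟩
  · exact mul_nonneg hL.le hU.1.le
  · exact mul_le_of_le_one_right hL.le hU.2.le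
  · exact mul_nonneg hM.le hV.1.le
  · exact mul_le_of_le_one_right hM.le hV.2.le
  · rw [h] at hu
    exact hU.1.ne' (add_arc_inj ht ⟨hU.1.le, hU.2.le⟩ ⟨le_rfl, zero_le_one⟩ (by simpa using hu))
  · rw [h] at hu
    refine hU.2.ne (add_arc_inj ht ⟨hU.1.le, hU.2.le⟩ ⟨zero_le_one, le_rfl⟩ ?_)
    rw [hu, mul_one, add_arcLen]

theorem isClosedEmbedding_saddle_comp {X : Type*} [TopologicalSpace X] [CompactSpace X]
    {t1 t2 p1 p2 : Real.Angle} (ht : t1 ≠ t2) (hp : p1 ≠ p2) {f : X → ℂ} (hf : Continuous f)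
    (hinj : Function.Injective f) (hle : ∀ x, ‖f x‖ ≤ 1) :
    IsClosedEmbedding fun x => saddle t1 t2 p1 p2 (f x) :=
  ((continuous_saddle t1 t2 p1 p2).comp hf).isClosedEmbedding
    fun x y h => hinj (saddle_injOn ht hp (hle x) (hle y) h)

theorem isOpenArc_saddle_image {t1 t2 p1 p2 : Real.Angle} (ht : t1 ≠ t2) (hp : p1 ≠ p2) {u : ℂ}
    (hu : ‖u‖ = 1) {a b : ℝ} (hab : a < b) (ha : -π ≤ a) (hb : b ≤ π) (hlt : b - a < 2 * π) :
    IsOpenArc (saddle t1 t2 p1 p2 '' {z | ‖z‖ = 1 ∧ Complex.arg (u * z) ∈ Set.Ioo a b}) := by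
  have hu0 : u ≠ 0 := by rintro rfl; simp at hu
  let f : Set.Icc (0 : ℝ) 1 → ℂ := fun s =>
    u⁻¹ * Complex.exp (((a + s * (b - a) : ℝ) : ℂ) * Complex.I)
  have hnorm : ∀ s, ‖f s‖ = 1 := fun s => by
    simp only [f, norm_mul, norm_inv, hu, Complex.norm_exp_ofReal_mul_I, inv_one, mul_one]
  have hcont : Continuous f := by fun_prop
  have hinj : Function.Injective f := by
    intro s s' h
    have h2 := mul_left_cancel₀ (inv_ne_zero hu0) h
    rw [← expA_coe, ← expA_coe] at h2
    have h3 := coe_angle_inj ?_ (expA_injective h2)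
    · have h4 : (s : ℝ) * (b - a) = s' * (b - a) := by linarith
      exact Subtype.ext (mul_right_cancel₀ (sub_pos.mpr hab).ne' h4)
    · rw [add_sub_add_left_eq_sub, ← sub_mul, abs_mul, abs_of_pos (sub_pos.mpr hab)]
      have : |(s : ℝ) - s'| ≤ 1 :=
        abs_le.mpr ⟨by linarith [s.2.1, s'.2.2], by linarith [s.2.2, s'.2.1]⟩
      nlinarith
  have hemb := (isClosedEmbedding_saddle_comp ht hp hcont hinj
    fun s => (hnorm s).le).isEmbedding.comp (.inclusion (Set.Ioo_subset_Icc_self))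
  have hrange : Set.range ((fun s => saddle t1 t2 p1 p2 (f s)) ∘
      Set.inclusion (Set.Ioo_subset_Icc_self (a := (0 : ℝ)) (b := 1))) =
      saddle t1 t2 p1 p2 '' {z | ‖z‖ = 1 ∧ Complex.arg (u * z) ∈ Set.Ioo a b} := by
    ext q
    constructor
    · rintro ⟨⟨s, hs0, hs1⟩, rfl⟩
      refine ⟨_, ⟨hnorm _, ?_⟩, rfl⟩
      have h1 : a < a + s * (b - a) := by nlinarith
      have h2 : a + s * (b - a) < b := by nlinarith
      simp only [f, Set.inclusion]
      rw [mul_inv_cancel_left₀ hu0, Complex.exp_mul_I, Complex.arg_cos_add_sin_mul_I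
        ⟨by linarith, by linarith⟩]
      exact ⟨h1, h2⟩
    · rintro ⟨z, ⟨hz, h1, h2⟩, rfl⟩
      have hba : 0 < b - a := by linarith
      refine ⟨⟨(Complex.arg (u * z) - a) / (b - a), by apply div_pos <;> linarith,
        by rw [div_lt_one hba]; linarith⟩, ?_⟩
      simp only [f, Set.inclusion, Function.comp]
      rw [div_mul_cancel₀ _ hba.ne', add_sub_cancel]
      have := Complex.norm_mul_exp_arg_mul_I (u * z)
      rw [norm_mul, hu, hz, mul_one, Complex.ofReal_one, one_mul] at this
      rw [this, inv_mul_cancel_left₀ hu0]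
  rw [IsOpenArc, ← hrange]
  exact ⟨hemb.toHomeomorph⟩

theorem isOpenArc_of_quadrant {t1 t2 p1 p2 : Real.Angle} (ht : t1 ≠ t2) (hp : p1 ≠ p2)
    {u : ℂ} (hu : ‖u‖ = 1) {S : Set ℂ}
    (hS : ∀ z, z ∈ S ↔ ‖z‖ = 1 ∧ 0 < (u * z).re ∧ 0 < (u * z).im) :
    IsOpenArc (saddle t1 t2 p1 p2 '' S) := by
  have hpi := Real.pi_pos
  convert isOpenArc_saddle_image ht hp hu (a := 0) (b := π / 2) (by linarith) (by linarith)
    (by linarith) (by linarith) using 2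
  ext z
  rw [hS]
  refine and_congr_right fun hz => ?_
  have hne : u * z ≠ 0 := by rw [← norm_ne_zero_iff, norm_mul, hu, hz]; norm_num
  have h1 := Complex.abs_arg_lt_pi_div_two_iff (z := u * z)
  have h2 := Complex.arg_nonneg_iff (z := u * z)
  have h3 := Complex.arg_eq_zero_iff (z := u * z)
  simp only [hne, or_false] at h1
  rw [Set.mem_Ioo]
  grind

theorem isOpenArc_of_half {t1 t2 p1 p2 : Real.Angle} (ht : t1 ≠ t2) (hp : p1 ≠ p2)
    {u : ℂ} (hu : ‖u‖ = 1) {S : Set ℂ}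
    (hS : ∀ z, z ∈ S ↔ ‖z‖ = 1 ∧ 0 < (u * z).re) :
    IsOpenArc (saddle t1 t2 p1 p2 '' S) := by
  have hpi := Real.pi_pos
  convert isOpenArc_saddle_image ht hp hu (a := -(π / 2)) (b := π / 2) (by linarith) (by linarith)
    (by linarith) (by linarith) using 2
  ext z
  rw [hS]
  refine and_congr_right fun hz => ?_
  have hne : u * z ≠ 0 := by rw [← norm_ne_zero_iff, norm_mul, hu, hz]; norm_num
  have h1 := Complex.abs_arg_lt_pi_div_two_iff (z := u * z)
  simp only [hne, or_false] at h1
  rw [← h1, abs_lt, Set.mem_Ioo]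

theorem isOpenArc_of_three_quadrants {t1 t2 p1 p2 : Real.Angle} (ht : t1 ≠ t2) (hp : p1 ≠ p2)
    {u : ℂ} (hu : ‖u‖ = 1) {S : Set ℂ}
    (hS : ∀ z, z ∈ S ↔ ‖z‖ = 1 ∧ (0 < (u * z).re ∨ 0 < (u * z).im)) :
    IsOpenArc (saddle t1 t2 p1 p2 '' S) := by
  have hpi := Real.pi_pos
  convert isOpenArc_saddle_image ht hp hu (a := -(π / 2)) (b := π) (by linarith) (by linarith)
    (by linarith) (by linarith) using 2
  ext z
  rw [hS]
  refine and_congr_right fun hz => ?_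
  have hne : u * z ≠ 0 := by rw [← norm_ne_zero_iff, norm_mul, hu, hz]; norm_num
  have h1 := Complex.neg_pi_div_two_lt_arg_iff (z := u * z)
  have h2 := Complex.arg_lt_pi_iff (z := u * z)
  have h3 : ¬ ((u * z).re = 0 ∧ (u * z).im = 0) := fun h => hne (Complex.ext h.1 h.2)
  rw [Set.mem_Ioo, h1, h2]
  grind

/-- The points of the unit circle all of whose adjacent corners belong to `V`. -/
def cornerArc (t1 t2 p1 p2 : Real.Angle) (V : Finset Torus) : Set ℂ :=
  {z | ‖z‖ = 1 ∧ ∀ T P, OnSide t1 t2 z.re T → OnSide p1 p2 z.im P → (T, P) ∈ V}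

theorem mem_cornerArc_iff {t1 t2 p1 p2 : Real.Angle} {V : Finset Torus} {z : ℂ} :
    z ∈ cornerArc t1 t2 p1 p2 V ↔ ‖z‖ = 1 ∧ (z.re ≤ 0 → z.im ≤ 0 → (t1, p1) ∈ V) ∧
      (z.re ≤ 0 → 0 ≤ z.im → (t1, p2) ∈ V) ∧ (0 ≤ z.re → z.im ≤ 0 → (t2, p1) ∈ V) ∧
      (0 ≤ z.re → 0 ≤ z.im → (t2, p2) ∈ V) := by
  refine and_congr_right fun _ => ⟨fun h => ⟨fun a b => h _ _ (.inl ⟨rfl, a⟩) (.inl ⟨rfl, b⟩),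
    fun a b => h _ _ (.inl ⟨rfl, a⟩) (.inr ⟨rfl, b⟩),
    fun a b => h _ _ (.inr ⟨rfl, a⟩) (.inl ⟨rfl, b⟩),
    fun a b => h _ _ (.inr ⟨rfl, a⟩) (.inr ⟨rfl, b⟩)⟩, ?_⟩
  rintro ⟨h11, h12, h21, h22⟩ T P (⟨rfl, a⟩ | ⟨rfl, a⟩) (⟨rfl, b⟩ | ⟨rfl, b⟩)
  exacts [h11 a b, h12 a b, h21 a b, h22 a b]

theorem isOpenArc_cornerArc {t1 t2 p1 p2 : Real.Angle} (ht : t1 ≠ t2) (hp : p1 ≠ p2)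
    {V : Finset Torus}
    (hadj : ((t1, p1) ∈ V ↔ (t1, p2) ∈ V) ∨ ((t2, p1) ∈ V ↔ (t2, p2) ∈ V) ∨
      ((t1, p1) ∈ V ↔ (t2, p1) ∈ V) ∨ ((t1, p2) ∈ V ↔ (t2, p2) ∈ V))
    (hin : (t1, p1) ∈ V ∨ (t1, p2) ∈ V ∨ (t2, p1) ∈ V ∨ (t2, p2) ∈ V)
    (hout : (t1, p1) ∉ V ∨ (t1, p2) ∉ V ∨ (t2, p1) ∉ V ∨ (t2, p2) ∉ V) :
    IsOpenArc (saddle t1 t2 p1 p2 '' cornerArc t1 t2 p1 p2 V) := by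
  have h1 : ‖(1 : ℂ)‖ = 1 := norm_one
  have h2 : ‖(-1 : ℂ)‖ = 1 := by simp
  have h3 : ‖Complex.I‖ = 1 := Complex.norm_I
  have h4 : ‖-Complex.I‖ = 1 := by simp
  by_cases a11 : (t1, p1) ∈ V <;> by_cases a12 : (t1, p2) ∈ V <;>
    by_cases a21 : (t2, p1) ∈ V <;> by_cases a22 : (t2, p2) ∈ V
  · simp [a11, a12, a21, a22] at hout
  · refine isOpenArc_of_three_quadrants ht hp h2 fun z => ?_
    simp [mem_cornerArc_iff, a11, a12, a21, a22]
    grind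
  · refine isOpenArc_of_three_quadrants ht hp h4 fun z => ?_
    simp [mem_cornerArc_iff, a11, a12, a21, a22]
    grind
  · refine isOpenArc_of_half ht hp h2 fun z => ?_
    simp [mem_cornerArc_iff, a11, a12, a21, a22]
    grind
  · refine isOpenArc_of_three_quadrants ht hp h3 fun z => ?_
    simp [mem_cornerArc_iff, a11, a12, a21, a22]
    grind
  · refine isOpenArc_of_half ht hp h3 fun z => ?_
    simp [mem_cornerArc_iff, a11, a12, a21, a22]
    grind
  · simp [a11, a12, a21, a22] at hadj
  · refine isOpenArc_of_quadrant ht hp h2 fun z => ?_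
    simp [mem_cornerArc_iff, a11, a12, a21, a22]
    grind
  · refine isOpenArc_of_three_quadrants ht hp h1 fun z => ?_
    simp [mem_cornerArc_iff, a11, a12, a21, a22]
    grind
  · simp [a11, a12, a21, a22] at hadj
  · refine isOpenArc_of_half ht hp h4 fun z => ?_
    simp [mem_cornerArc_iff, a11, a12, a21, a22]
    grind
  · refine isOpenArc_of_quadrant ht hp h4 fun z => ?_
    simp [mem_cornerArc_iff, a11, a12, a21, a22]
    grind
  · refine isOpenArc_of_half ht hp h1 fun z => ?_
    simp [mem_cornerArc_iff, a11, a12, a21, a22]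
    grind
  · refine isOpenArc_of_quadrant ht hp h3 fun z => ?_
    simp [mem_cornerArc_iff, a11, a12, a21, a22]
    grind
  · refine isOpenArc_of_quadrant ht hp h1 fun z => ?_
    simp [mem_cornerArc_iff, a11, a12, a21, a22]
    grind
  · simp [a11, a12, a21, a22] at hin

theorem mem_corners_iff {t1 t2 p1 p2 : Real.Angle} {v : Torus} :
    v ∈ corners t1 t2 p1 p2 ↔ (v.1 = t1 ∨ v.1 = t2) ∧ (v.2 = p1 ∨ v.2 = p2) := by
  simp only [corners, Finset.mem_insert, Finset.mem_singleton, Prod.ext_iff]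
  tauto

theorem eq_of_longitude (R : RectDiagram) {a b c : Torus} (ha : a ∈ R.verts) (hb : b ∈ R.verts)
    (hc : c ∈ R.verts) (hab : a ≠ b) (h1 : a.2 = c.2) (h2 : b.2 = c.2) : c = a ∨ c = b := by
  rcases R.diag.2 c.2 with h | ⟨u, w, -, -, -, -, -, -, h⟩
  · exact absurd rfl (h c hc)
  · have := h a ha h1
    have := h b hb h2
    have := h c hc rfl
    grind

theorem eq_of_meridian (R : RectDiagram) {a b c : Torus} (ha : a ∈ R.verts) (hb : b ∈ R.verts)
    (hc : c ∈ R.verts) (hab : a ≠ b) (h1 : a.1 = c.1) (h2 : b.1 = c.1) : c = a ∨ c = b := by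
  rcases R.diag.1 c.1 with h | ⟨u, w, -, -, -, -, -, -, h⟩
  · exact absurd rfl (h c hc)
  · have := h a ha h1
    have := h b hb h2
    have := h c hc rfl
    grind

theorem mem_hatLink {R : RectDiagram} {q : ℂ × ℂ} :
    q ∈ hatLink R ↔ ∃ v ∈ R.verts, q ∈ vertArc v := by
  simp [hatLink]

theorem vertArc_corner_subset {t1 t2 p1 p2 : Real.Angle} {v : Torus}
    (hv : v ∈ corners t1 t2 p1 p2) : vertArc v ⊆ joinSet {t1, t2} {p1, p2} := by
  rintro _ ⟨s, h0, h1, rfl⟩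
  obtain ⟨ha, hb⟩ := mem_corners_iff.mp hv
  exact ⟨_, ha, _, hb, s, h0, h1, rfl⟩

theorem hatLink_diff_eq {A B : RectDiagram} {t1 t2 p1 p2 : Real.Angle} (ht : t1 ≠ t2)
    (hp : p1 ≠ p2) (hAB : symmDiff A.verts B.verts = corners t1 t2 p1 p2) :
    hatLink A \ hatLink B = saddle t1 t2 p1 p2 '' cornerArc t1 t2 p1 p2 A.verts := by
  have hsd : ∀ v, (v ∈ A.verts ∧ v ∉ B.verts ∨ v ∈ B.verts ∧ v ∉ A.verts) ↔
      (v.1 = t1 ∨ v.1 = t2) ∧ (v.2 = p1 ∨ v.2 = p2) := fun v => by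
    rw [← mem_corners_iff, ← hAB, Finset.mem_symmDiff]
  apply Set.Subset.antisymm
  · rintro q ⟨hqA, hqB⟩
    obtain ⟨v, hvA, hv⟩ := mem_hatLink.mp hqA
    have hvB : v ∉ B.verts := fun h => hqB (mem_hatLink.mpr ⟨v, h, hv⟩)
    have hvc := vertArc_corner_subset (mem_corners_iff.mpr ((hsd v).mp (.inl ⟨hvA, hvB⟩))) hv
    rw [← saddle_image_sphere] at hvc
    obtain ⟨z, hz, rfl⟩ := hvc
    have hz : ‖z‖ = 1 := hz
    refine ⟨z, ⟨hz, fun T P hT hP => ?_⟩, rfl⟩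
    by_contra hTP
    have hB : (T, P) ∈ B.verts := by
      rcases (hsd (T, P)).mpr ⟨hT.imp And.left And.left, hP.imp And.left And.left⟩ with
        ⟨h, -⟩ | ⟨h, -⟩
      exacts [absurd h hTP, h]
    have hn := norm_sq_eq z
    rw [hz] at hn
    exact hqB (mem_hatLink.mpr ⟨_, hB, z.re ^ 2, sq_nonneg _, by nlinarith [sq_nonneg z.im],
      saddle_of_norm_eq_one hz hT hP⟩)
  · rintro _ ⟨z, ⟨hz, h⟩, rfl⟩
    have hn := norm_sq_eq z
    rw [hz] at hn
    have h0 : 0 ≤ z.re ^ 2 := sq_nonneg _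
    have h1 : z.re ^ 2 ≤ 1 := by nlinarith [sq_nonneg z.im]
    obtain ⟨T, hT⟩ := exists_onSide t1 t2 z.re
    obtain ⟨P, hP⟩ := exists_onSide p1 p2 z.im
    have hTt : T = t1 ∨ T = t2 := hT.imp And.left And.left
    have hPp : P = p1 ∨ P = p2 := hP.imp And.left And.left
    have hTP := h T P hT hP
    have hTPB : (T, P) ∉ B.verts := fun hB => by
      rcases (hsd (T, P)).mpr ⟨hTt, hPp⟩ with ⟨-, h⟩ | ⟨-, h⟩
      exacts [h hB, h hTP]
    have hq := saddle_of_norm_eq_one hz hT hP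
    refine ⟨mem_hatLink.mpr ⟨_, hTP, z.re ^ 2, h0, h1, hq⟩, fun hB => ?_⟩
    obtain ⟨v, hv, s, s0, s1, hs⟩ := mem_hatLink.mp hB
    rw [hq] at hs
    obtain ⟨-, hu, hw⟩ := sphPt_inj h0 h1 s0 s1 hs
    have hv' := hsd v
    by_cases hx : z.re = 0
    · have hvP : P = v.2 := hw (by rw [hx]; norm_num)
      have hA1 : (t1, P) ∈ A.verts := h _ _ (.inl ⟨rfl, hx.le⟩) hP
      have hA2 : (t2, P) ∈ A.verts := h _ _ (.inr ⟨rfl, hx.ge⟩) hP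
      have hvt : v.1 = t1 ∨ v.1 = t2 := by
        by_cases hvA : v ∈ A.verts
        · exact (eq_of_longitude A hA1 hA2 hvA (fun e => ht (congrArg Prod.fst e)) hvP hvP).imp
            (congrArg Prod.fst) (congrArg Prod.fst)
        · exact (hv'.mp (.inr ⟨hv, hvA⟩)).1
      have hvA : v ∈ A.verts := by
        rcases hvt with e | e
        · rwa [show v = (t1, P) from Prod.ext e hvP.symm]
        · rwa [show v = (t2, P) from Prod.ext e hvP.symm]
      rcases hv'.mpr ⟨hvt, hvP ▸ hPp⟩ with ⟨-, h⟩ | ⟨-, h⟩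
      exacts [h hv, h hvA]
    · have hvT : T = v.1 := hu (pow_ne_zero 2 hx)
      by_cases hy : z.im = 0
      · have hA1 : (T, p1) ∈ A.verts := h _ _ hT (.inl ⟨rfl, hy.le⟩)
        have hA2 : (T, p2) ∈ A.verts := h _ _ hT (.inr ⟨rfl, hy.ge⟩)
        have hvp : v.2 = p1 ∨ v.2 = p2 := by
          by_cases hvA : v ∈ A.verts
          · exact (eq_of_meridian A hA1 hA2 hvA (fun e => hp (congrArg Prod.snd e)) hvT hvT).imp
              (congrArg Prod.snd) (congrArg Prod.snd)
          · exact (hv'.mp (.inr ⟨hv, hvA⟩)).2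
        have hvA : v ∈ A.verts := by
          rcases hvp with e | e
          · rwa [show v = (T, p1) from Prod.ext hvT.symm e]
          · rwa [show v = (T, p2) from Prod.ext hvT.symm e]
        rcases hv'.mpr ⟨hvT ▸ hTt, hvp⟩ with ⟨-, h⟩ | ⟨-, h⟩
        exacts [h hv, h hvA]
      · have hvP : P = v.2 := hw (fun e => hy (by
          have : z.im ^ 2 = 0 := by linarith
          exact pow_eq_zero_iff two_ne_zero |>.mp this))
        exact hTPB (by rwa [show (T, P) = v from Prod.ext hvT hvP])

theorem mem_closure_off_axes {z : ℂ} (hz : ‖z‖ = 1) :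
    z ∈ closure {w : ℂ | ‖w‖ = 1 ∧ w.re ≠ 0 ∧ w.im ≠ 0} := by
  by_cases h0 : z.re ≠ 0 ∧ z.im ≠ 0
  · exact subset_closure ⟨hz, h0⟩
  have hre : z.re = 0 ∨ z.im = 0 := by tauto
  have hn := norm_sq_eq z
  have hf : Continuous fun ε : ℝ => z * Complex.exp ((ε : ℂ) * Complex.I) := by fun_prop
  have htend := (hf.tendsto 0).mono_left (nhdsWithin_le_nhds (s := Set.Ioi 0))
  simp only [Complex.ofReal_zero, zero_mul, Complex.exp_zero, mul_one] at htend
  refine mem_closure_of_tendsto htend ?_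
  have hpi := Real.pi_pos
  filter_upwards [Ioo_mem_nhdsGT (show (0 : ℝ) < π / 2 by linarith)] with ε hε
  have hs : Real.sin ε ≠ 0 := (Real.sin_pos_of_pos_of_lt_pi hε.1 (by linarith [hε.2])).ne'
  have hc : Real.cos ε ≠ 0 := (Real.cos_pos_of_mem_Ioo ⟨by linarith [hε.1], hε.2⟩).ne'
  rw [hz] at hn
  refine ⟨by rw [norm_mul, hz, Complex.norm_exp_ofReal_mul_I, one_mul], ?_⟩
  rw [Complex.mul_re, Complex.mul_im, Complex.exp_ofReal_mul_I_re, Complex.exp_ofReal_mul_I_im]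
  rcases hre with h | h <;> simp only [h] at hn ⊢
  · have : z.im ≠ 0 := by intro h; simp [h] at hn
    simp [this, hs, hc]
  · have : z.re ≠ 0 := by intro h; simp [h] at hn
    simp [this, hs, hc]

theorem closure_saddle_image {t1 t2 p1 p2 : Real.Angle} {S : Set ℂ} (hS : ∀ z ∈ S, ‖z‖ = 1)
    (hS' : {w : ℂ | ‖w‖ = 1 ∧ w.re ≠ 0 ∧ w.im ≠ 0} ⊆ S) :
    closure (saddle t1 t2 p1 p2 '' S) = saddle t1 t2 p1 p2 '' {z | ‖z‖ = 1} := by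
  have hcont := continuous_saddle t1 t2 p1 p2
  apply Set.Subset.antisymm
  · have hcpt : IsCompact {z : ℂ | ‖z‖ = 1} := by
      convert isCompact_sphere (0 : ℂ) 1 using 1
      ext; simp
    exact closure_minimal (Set.image_mono hS) (hcpt.image hcont).isClosed
  · rintro _ ⟨z, hz, rfl⟩
    exact image_closure_subset_closure_image hcont
      ⟨z, closure_mono hS' (mem_closure_off_axes hz), rfl⟩

theorem nonempty_angle_homeomorph_join {t1 t2 p1 p2 : Real.Angle} (ht : t1 ≠ t2) (hp : p1 ≠ p2) :
    Nonempty (Real.Angle ≃ₜ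
      ↥(joinSet ({t1, t2} : Set Real.Angle) ({p1, p2} : Set Real.Angle))) := by
  have hemb := isClosedEmbedding_saddle_comp (X := Circle) ht hp
    (f := fun z => (z : ℂ)) continuous_subtype_val Circle.coe_injective fun z => (Circle.norm_coe z).le
  have hr : Set.range (fun z : Circle => saddle t1 t2 p1 p2 z) = joinSet {t1, t2} {p1, p2} := by
    rw [← saddle_image_sphere]
    ext q
    constructor
    · rintro ⟨z, rfl⟩
      exact ⟨z, Circle.norm_coe z, rfl⟩
    · rintro ⟨z, hz, rfl⟩
      exact ⟨⟨z, mem_sphere_zero_iff_norm.mpr hz⟩, rfl⟩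
  rw [← hr]
  exact ⟨AddCircle.homeomorphCircle'.trans hemb.isEmbedding.toHomeomorph⟩

theorem isEdge_corners {R : RectDiagram} {t1 t2 p1 p2 : Real.Angle} {u v : Torus}
    (hu : u ∈ corners t1 t2 p1 p2) (hv : v ∈ corners t1 t2 p1 p2) (h : IsEdge R u v) :
    ((t1, p1) ∈ R.verts ∧ (t1, p2) ∈ R.verts) ∨ ((t2, p1) ∈ R.verts ∧ (t2, p2) ∈ R.verts) ∨
      ((t1, p1) ∈ R.verts ∧ (t2, p1) ∈ R.verts) ∨ ((t1, p2) ∈ R.verts ∧ (t2, p2) ∈ R.verts) := by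
  obtain ⟨hu1, hv1, hne, he⟩ := h
  obtain ⟨a, b⟩ := u
  obtain ⟨c, d⟩ := v
  rw [mem_corners_iff] at hu hv
  grind

theorem iff_or_iff_of_complement {a b c d a' b' c' d' : Prop} (ha : a ↔ ¬a') (hb : b ↔ ¬b')
    (hc : c ↔ ¬c') (hd : d ↔ ¬d')
    (h : (a ∧ b ∨ c ∧ d ∨ a ∧ c ∨ b ∧ d) ∨ (a' ∧ b' ∨ c' ∧ d' ∨ a' ∧ c' ∨ b' ∧ d')) :
    (a ↔ b) ∨ (c ↔ d) ∨ (a ↔ c) ∨ (b ↔ d) := by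
  grind

theorem mem_cornerArc_union {t1 t2 p1 p2 : Real.Angle} {V W : Finset Torus}
    (h11 : (t1, p1) ∈ V ↔ (t1, p1) ∉ W) (h12 : (t1, p2) ∈ V ↔ (t1, p2) ∉ W)
    (h21 : (t2, p1) ∈ V ↔ (t2, p1) ∉ W) (h22 : (t2, p2) ∈ V ↔ (t2, p2) ∉ W) {z : ℂ}
    (hz : ‖z‖ = 1) (hx : z.re ≠ 0) (hy : z.im ≠ 0) :
    z ∈ cornerArc t1 t2 p1 p2 V ∪ cornerArc t1 t2 p1 p2 W := by
  rw [Set.mem_union, mem_cornerArc_iff, mem_cornerArc_iff]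
  rcases lt_or_gt_of_ne hx with hx | hx <;> rcases lt_or_gt_of_ne hy with hy | hy <;>
    simp only [hz, hx.le, hx.not_ge, hy.le, hy.not_ge, h11, h12, h21, h22, true_and, and_true,
      forall_const, false_imp_iff]
  all_goals exact (em _).symm

/-- If `R₁ ↦ R₂` is an elementary move associated with the rectangle `[θ₁;θ₂]×[φ₁;φ₂]`,
then `R̂₁ △ R̂₂` is a union of two disjoint open arcs `α ⊂ R̂₁`, `β ⊂ R̂₂` whose closure is
the simple closed curve `{θ₁,θ₂}*{φ₁,φ₂}`, and there is an embedded 2-disc `d` inside the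
join `[θ₁;θ₂]*[φ₁;φ₂]` with `d ∩ (R̂₁ ∪ R̂₂) = ∂d = closure (α ∪ β)`. -/
theorem elem_move_disc (R₁ R₂ : RectDiagram) (t1 t2 p1 p2 : Real.Angle)
    (h : IsElemMoveWith R₁ R₂ t1 t2 p1 p2) :
    ∃ α β : Set (ℂ × ℂ),
      IsOpenArc α ∧ IsOpenArc β ∧ α ⊆ hatLink R₁ ∧ β ⊆ hatLink R₂ ∧ Disjoint α β ∧
      (hatLink R₁ \ hatLink R₂) ∪ (hatLink R₂ \ hatLink R₁) = α ∪ β ∧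
      closure (α ∪ β) = joinSet ({t1, t2} : Set Real.Angle) ({p1, p2} : Set Real.Angle) ∧
      Nonempty (Real.Angle ≃ₜ
        ↥(joinSet ({t1, t2} : Set Real.Angle) ({p1, p2} : Set Real.Angle))) ∧
      ∃ (d : Set (ℂ × ℂ)) (e : ↥unitDisc → ℂ × ℂ),
        Topology.IsEmbedding e ∧ Set.range e = d ∧
        d ⊆ joinSet (Arc t1 t2) (Arc p1 p2) ∧
        d ∩ (hatLink R₁ ∪ hatLink R₂) = closure (α ∪ β) ∧
        e '' {z : ↥unitDisc | ‖(z : ℂ)‖ = 1} = closure (α ∪ β) := by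
  obtain ⟨ht, hp, hsd, ⟨u, v, hu, hv, hedge⟩, hn1, hn2, hrect, -⟩ := h
  have hsd' : symmDiff R₂.verts R₁.verts = corners t1 t2 p1 p2 := by rw [symmDiff_comm, hsd]
  have hxor : ∀ T P, (T = t1 ∨ T = t2) → (P = p1 ∨ P = p2) →
      ((T, P) ∈ R₁.verts ↔ (T, P) ∉ R₂.verts) := fun T P hT hP => by
    have : (T, P) ∈ symmDiff R₁.verts R₂.verts := by rw [hsd, mem_corners_iff]; exact ⟨hT, hP⟩
    rw [Finset.mem_symmDiff] at this
    tauto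
  have e11 := hxor t1 p1 (.inl rfl) (.inl rfl)
  have e12 := hxor t1 p2 (.inl rfl) (.inr rfl)
  have e21 := hxor t2 p1 (.inr rfl) (.inl rfl)
  have e22 := hxor t2 p2 (.inr rfl) (.inr rfl)
  rw [hsd] at hu hv
  have hex : ∀ A B : RectDiagram, symmDiff A.verts B.verts = corners t1 t2 p1 p2 →
      ¬ A.verts ⊆ B.verts → (t1, p1) ∈ A.verts ∨ (t1, p2) ∈ A.verts ∨ (t2, p1) ∈ A.verts ∨
        (t2, p2) ∈ A.verts := by
    intro A B hAB hn
    obtain ⟨w, hwA, hwB⟩ := Finset.not_subset.mp hn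
    have hw : w ∈ corners t1 t2 p1 p2 := by
      rw [← hAB, Finset.mem_symmDiff]; exact .inl ⟨hwA, hwB⟩
    simp only [corners, Finset.mem_insert, Finset.mem_singleton] at hw
    grind
  have hin1 := hex R₁ R₂ hsd hn1
  have hin2 := hex R₂ R₁ hsd' hn2
  have hedge' := hedge.imp (isEdge_corners hu hv) (isEdge_corners hu hv)
  have hunion : saddle t1 t2 p1 p2 '' cornerArc t1 t2 p1 p2 R₁.verts ∪
      saddle t1 t2 p1 p2 '' cornerArc t1 t2 p1 p2 R₂.verts =
      saddle t1 t2 p1 p2 '' (cornerArc t1 t2 p1 p2 R₁.verts ∪ cornerArc t1 t2 p1 p2 R₂.verts) :=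
    (Set.image_union _ _ _).symm
  have hclosure : closure (saddle t1 t2 p1 p2 '' cornerArc t1 t2 p1 p2 R₁.verts ∪
      saddle t1 t2 p1 p2 '' cornerArc t1 t2 p1 p2 R₂.verts) =
      saddle t1 t2 p1 p2 '' {z | ‖z‖ = 1} := by
    rw [hunion]
    refine closure_saddle_image (fun z hz => hz.elim And.left And.left) ?_
    exact fun z ⟨hz, hx, hy⟩ => mem_cornerArc_union e11 e12 e21 e22 hz hx hy
  have hd1 := hatLink_diff_eq ht hp hsd
  have hd2 := hatLink_diff_eq ht hp hsd'
  refine ⟨saddle t1 t2 p1 p2 '' cornerArc t1 t2 p1 p2 R₁.verts,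
    saddle t1 t2 p1 p2 '' cornerArc t1 t2 p1 p2 R₂.verts,
    isOpenArc_cornerArc ht hp (iff_or_iff_of_complement e11 e12 e21 e22 hedge') hin1
      (hin2.imp (iff_not_comm.mp e11).mp (Or.imp (iff_not_comm.mp e12).mp (Or.imp (iff_not_comm.mp e21).mp (iff_not_comm.mp e22).mp))),
    isOpenArc_cornerArc ht hp (iff_or_iff_of_complement (iff_not_comm.mp e11)
      (iff_not_comm.mp e12) (iff_not_comm.mp e21) (iff_not_comm.mp e22) hedge'.symm) hin2
      (hin1.imp e11.mp (Or.imp e12.mp (Or.imp e21.mp e22.mp))),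
    hd1 ▸ Set.sdiff_subset, hd2 ▸ Set.sdiff_subset, ?_, by rw [hd1, hd2],
    by rw [hclosure, saddle_image_sphere], nonempty_angle_homeomorph_join ht hp, ?_⟩
  · rw [← hd1, ← hd2]
    exact Set.disjoint_left.mpr fun q h1 h2 => h1.2 h2.1
  have hle : ∀ z : ↥unitDisc, ‖(z : ℂ)‖ ≤ 1 := fun z => mem_closedBall_zero_iff.mp z.2
  have : CompactSpace ↥unitDisc := isCompact_iff_compactSpace.mp (isCompact_closedBall 0 1)
  refine ⟨_, fun z => saddle t1 t2 p1 p2 z, (isClosedEmbedding_saddle_comp ht hp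
    continuous_subtype_val Subtype.val_injective hle).isEmbedding, rfl, ?_, ?_, ?_⟩
  · rintro _ ⟨z, rfl⟩
    exact saddle_mem_join ht hp (hle z)
  · rw [hclosure]
    apply Set.Subset.antisymm
    · rintro _ ⟨⟨z, rfl⟩, hz⟩
      refine ⟨z, ?_, rfl⟩
      by_contra hne
      have hlt : ‖(z : ℂ)‖ < 1 := lt_of_le_of_ne (hle z) hne
      have key : ∀ w : Torus, w ∈ R₁.verts ∨ w ∈ R₂.verts →
          saddle t1 t2 p1 p2 z ∉ vertArc w := fun w hw hzw => by
        obtain ⟨hwr, hw1, hw2⟩ := saddle_interior_mem_vertArc ht hp hlt hzw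
        have : w ∈ (corners t1 t2 p1 p2 : Set Torus) := hrect ▸ ⟨hwr, hw⟩
        exact (mem_corners_iff.mp this).1.elim hw1 hw2
      rcases hz with hz | hz <;> obtain ⟨w, hw, hzw⟩ := mem_hatLink.mp hz
      exacts [key w (.inl hw) hzw, key w (.inr hw) hzw]
    · intro q hq
      refine ⟨?_, ?_⟩
      · obtain ⟨z, hz, rfl⟩ := hq
        exact ⟨⟨z, mem_closedBall_zero_iff.mpr (le_of_eq hz)⟩, rfl⟩
      · rw [saddle_image_sphere] at hq
        obtain ⟨T, hT, P, hP, s, h0, h1, rfl⟩ := hq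
        have := hxor T P hT hP
        by_cases hA : (T, P) ∈ R₁.verts
        · exact .inl (mem_hatLink.mpr ⟨_, hA, s, h0, h1, rfl⟩)
        · exact .inr (mem_hatLink.mpr ⟨_, not_not.mp (mt this.mpr hA), s, h0, h1, rfl⟩)
  · rw [hclosure]
    ext q
    constructor
    · rintro ⟨z, hz, rfl⟩
      exact ⟨z, hz, rfl⟩
    · rintro ⟨z, hz, rfl⟩
      exact ⟨⟨z, mem_closedBall_zero_iff.mpr (le_of_eq hz)⟩, hz, rfl⟩

end RectDiag
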